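/- Let n ≥ 1 and let M = e^{-V} be a positive C² function on ℝⁿ with M ∈ L¹(ℝⁿ), and assume there exists ε > 0 such that (1-ε)|∇V(x)|²/2 - ΔV(x) → +∞ as |x| → ∞. Let α ∈ (0,2). Then there exist constants λ_α > 0 and δ > 0 such that for every f ∈ C_c^∞(ℝⁿ) with ∫_{ℝⁿ} f(x) M(x) dx = 0, one has ∬_{ℝⁿ×ℝⁿ} |f(x)-f(y)|² / |x-y|^{n+α} · M(x) e^{-δ|x-y|} dx dy ≥ λ_α ∫_{ℝⁿ} |f(x)|² (1 + |∇ ln M(x)|^α) M(x) dx. -/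

import Mathlib

open MeasureTheory Filter Real Set

/-- The Laplacian of a function on `EuclideanSpace ℝ (Fin n)`, defined as the sum of the
second derivatives in the coordinate directions. -/
noncomputable def laplacian {n : ℕ} (V : EuclideanSpace ℝ (Fin n) → ℝ)
    (x : EuclideanSpace ℝ (Fin n)) : ℝ :=
  ∑ i : Fin n, fderiv ℝ (fun y => fderiv ℝ V y (EuclideanSpace.single i 1)) x
    (EuclideanSpace.single i 1)

lemma cs_weighted {X : Type*} [MeasurableSpace X] (μ : Measure X) (a b w : X → ℝ)
    (hw : ∀ x, 0 ≤ w x)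
    (ha : Integrable (fun x => a x ^ 2 * w x) μ) (hb : Integrable (fun x => b x ^ 2 * w x) μ)
    (hab : Integrable (fun x => a x * b x * w x) μ) :
    (∫ x, a x * b x * w x ∂μ) ^ 2 ≤ (∫ x, a x ^ 2 * w x ∂μ) * ∫ x, b x ^ 2 * w x ∂μ := by
  have key : ∀ s : ℝ, 0 ≤ (∫ x, a x ^ 2 * w x ∂μ) * (s * s)
      + (2 * ∫ x, a x * b x * w x ∂μ) * s + ∫ x, b x ^ 2 * w x ∂μ := by
    intro s
    have h1 : 0 ≤ ∫ x, (s * a x + b x) ^ 2 * w x ∂μ :=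
      integral_nonneg fun x => mul_nonneg (sq_nonneg _) (hw x)
    have h2 : (fun x => (s * a x + b x) ^ 2 * w x)
        = fun x => (s * s) * (a x ^ 2 * w x) + (2 * s) * (a x * b x * w x) + b x ^ 2 * w x := by
      funext x; ring
    have i1 : Integrable (fun x => (s * s) * (a x ^ 2 * w x) + (2 * s) * (a x * b x * w x)) μ :=
      (ha.const_mul _).add (hab.const_mul _)
    rw [h2, integral_add i1 hb, integral_add (ha.const_mul _) (hab.const_mul _), integral_const_mul, integral_const_mul] at h1
    linarith
  have := discrim_le_zero key
  unfold discrim at this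
  nlinarith

lemma norm_gradient_sq {n : ℕ} (V : EuclideanSpace ℝ (Fin n) → ℝ)
    (x : EuclideanSpace ℝ (Fin n)) :
    ‖gradient V x‖ ^ 2 = ∑ i, (fderiv ℝ V x (EuclideanSpace.single i 1)) ^ 2 := by
  have h : ∀ i, fderiv ℝ V x (EuclideanSpace.single i 1) = gradient V x i := by
    intro i
    rw [← toDual_gradient, InnerProductSpace.toDual_apply_apply]
    rw [EuclideanSpace.inner_single_right]
    simp
  rw [EuclideanSpace.norm_sq_eq]
  simp [h]

lemma continuous_fderiv_apply_const {n : ℕ} {V : EuclideanSpace ℝ (Fin n) → ℝ}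
    (hV : ContDiff ℝ 1 V) (v : EuclideanSpace ℝ (Fin n)) :
    Continuous (fun x => fderiv ℝ V x v) :=
  (hV.continuous_fderiv (by norm_num)).clm_apply continuous_const

lemma contDiff_fderiv_apply_const {n : ℕ} {V : EuclideanSpace ℝ (Fin n) → ℝ}
    (hV : ContDiff ℝ 2 V) (v : EuclideanSpace ℝ (Fin n)) :
    ContDiff ℝ 1 (fun x => fderiv ℝ V x v) :=
  (hV.fderiv_right (m := 1) (by norm_num)).clm_apply contDiff_const

lemma continuous_laplacian {n : ℕ} {V : EuclideanSpace ℝ (Fin n) → ℝ}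
    (hV : ContDiff ℝ 2 V) : Continuous (laplacian V) := by
  unfold laplacian
  exact continuous_finsetSum _ fun i _ =>
    continuous_fderiv_apply_const (contDiff_fderiv_apply_const hV _) _

/-- integration by parts estimate, one direction -/
lemma ibp_one {n : ℕ} {V g : EuclideanSpace ℝ (Fin n) → ℝ}
    (hV : ContDiff ℝ 2 V) (hg : ContDiff ℝ 1 g) (hgc : HasCompactSupport g)
    (v : EuclideanSpace ℝ (Fin n)) :
    ∫ x, g x ^ 2 * Real.exp (-V x) * ((fderiv ℝ V x v) ^ 2 / 2
        - fderiv ℝ (fun y => fderiv ℝ V y v) x v)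
      ≤ 2 * ∫ x, (fderiv ℝ g x v) ^ 2 * Real.exp (-V x) := by
  have hV1 : ContDiff ℝ 1 V := hV.of_le (by norm_num)
  have hDV := contDiff_fderiv_apply_const hV v
  have cV := hV.continuous
  have cg := hg.continuous
  have cdV := hDV.continuous
  have cddV := continuous_fderiv_apply_const hDV v
  have cdg := continuous_fderiv_apply_const hg v
  have hdgc : HasCompactSupport (fun x => fderiv ℝ g x v) :=
    hgc.fderiv_apply (𝕜 := ℝ) v
  set u : EuclideanSpace ℝ (Fin n) → ℝ := fun x => g x ^ 2 * Real.exp (-V x) with hu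
  have hu1 : ContDiff ℝ 1 u := (hg.pow 2).mul (hV1.neg.exp)
  have huc : HasCompactSupport u := by
    apply HasCompactSupport.mul_right
    exact hgc.comp_left (g := fun y : ℝ => y ^ 2) (by simp)
  have hdu : ∀ x, fderiv ℝ u x v = 2 * g x * fderiv ℝ g x v * Real.exp (-V x)
      - g x ^ 2 * Real.exp (-V x) * fderiv ℝ V x v := by
    intro x
    have h1 : HasFDerivAt g (fderiv ℝ g x) x :=
      (hg.differentiable (by norm_num) x).hasFDerivAt
    have h2 : HasFDerivAt V (fderiv ℝ V x) x :=
      (hV1.differentiable (by norm_num) x).hasFDerivAt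
    have h3 := (h1.pow 2).mul (h2.neg.exp)
    have h4 : fderiv ℝ u x = _ := h3.fderiv
    rw [h4]
    simp
    ring
  have hcs : ∀ w : EuclideanSpace ℝ (Fin n) → ℝ, Continuous w → HasCompactSupport w →
      Integrable w := fun w h1 h2 => h1.integrable_of_hasCompactSupport h2
  have cu := hu1.continuous
  have cdu := continuous_fderiv_apply_const hu1 v
  have hduc : HasCompactSupport (fun x => fderiv ℝ u x v) := huc.fderiv_apply (𝕜 := ℝ) v
  have hibp := integral_mul_fderiv_eq_neg_fderiv_mul_of_integrable (μ := volume)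
    (f := u) (g := fun y => fderiv ℝ V y v) (v := v)
    (hcs _ (cdu.mul cdV) hduc.mul_right) (hcs _ (cu.mul cddV) huc.mul_right)
    (hcs _ (cu.mul cdV) huc.mul_right)
    (fun x _ => hu1.differentiable (by norm_num) x)
    (fun x _ => hDV.differentiable (by norm_num) x)
  have e1 : ∫ x, u x * ((fderiv ℝ V x v) ^ 2 / 2
        - fderiv ℝ (fun y => fderiv ℝ V y v) x v)
      = ∫ x, (u x * (fderiv ℝ V x v) ^ 2 / 2 + fderiv ℝ u x v * fderiv ℝ V x v) := by
    have i1 : Integrable (fun x => u x * (fderiv ℝ V x v) ^ 2 / 2) := by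
      have : Integrable (fun x => u x * ((fderiv ℝ V x v) ^ 2 / 2)) :=
        hcs _ (cu.mul ((cdV.pow 2).div_const 2)) huc.mul_right
      simpa [mul_div_assoc] using this
    have i2 : Integrable (fun x => u x * fderiv ℝ (fun y => fderiv ℝ V y v) x v) :=
      hcs _ (cu.mul cddV) huc.mul_right
    have i3 : Integrable (fun x => fderiv ℝ u x v * fderiv ℝ V x v) :=
      hcs _ (cdu.mul cdV) hduc.mul_right
    rw [integral_add i1 i3]
    have : ∀ x, u x * ((fderiv ℝ V x v) ^ 2 / 2 - fderiv ℝ (fun y => fderiv ℝ V y v) x v)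
      = u x * (fderiv ℝ V x v) ^ 2 / 2 - u x * fderiv ℝ (fun y => fderiv ℝ V y v) x v := by
      intro x; ring
    simp_rw [this]
    rw [integral_sub i1 i2, hibp]
    ring
  rw [e1, ← integral_const_mul]
  apply integral_mono
  · apply hcs _ (by fun_prop)
    have h1 : HasCompactSupport (fun x => u x * (fderiv ℝ V x v) ^ 2 / 2) := by
      simp_rw [mul_div_assoc]; exact huc.mul_right
    exact h1.add hduc.mul_right
  · apply hcs _ (by fun_prop)
    apply HasCompactSupport.mul_left
    apply HasCompactSupport.mul_right
    exact hdgc.comp_left (g := fun y : ℝ => y ^ 2) (by simp)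
  · intro x
    simp only [hdu]
    simp only [hu]
    have : 0 < Real.exp (-V x) := Real.exp_pos _
    have h2 := mul_nonneg this.le (sq_nonneg (2 * fderiv ℝ g x v - g x * fderiv ℝ V x v))
    nlinarith

lemma weighted_poincare {n : ℕ} {V : EuclideanSpace ℝ (Fin n) → ℝ}
    (hV : ContDiff ℝ 2 V)
    (hconf : ∃ ε > (0:ℝ), Tendsto
      (fun x => (1 - ε) * ‖gradient V x‖ ^ 2 / 2 - laplacian V x)
      (cocompact (EuclideanSpace ℝ (Fin n))) atTop) :
    ∃ C > (0:ℝ), ∃ R > (0:ℝ), ∀ g : EuclideanSpace ℝ (Fin n) → ℝ,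
      ContDiff ℝ 1 g → HasCompactSupport g →
      ∫ x, g x ^ 2 * (1 + ‖gradient V x‖ ^ 2) * Real.exp (-V x)
        ≤ C * ((∫ x, (∑ i, (fderiv ℝ g x (EuclideanSpace.single i 1)) ^ 2) * Real.exp (-V x))
          + ∫ x in Metric.closedBall 0 R, g x ^ 2 * Real.exp (-V x)) := by
  obtain ⟨ε, hε, hT⟩ := hconf
  have hV1 : ContDiff ℝ 1 V := hV.of_le (by norm_num)
  have cV := hV.continuous
  have cG : Continuous (fun x => ‖gradient V x‖ ^ 2) := by
    simp_rw [norm_gradient_sq]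
    exact continuous_finsetSum _ fun i _ => (continuous_fderiv_apply_const hV1 _).pow 2
  have cL := continuous_laplacian hV
  have h1 := hT.eventually_ge_atTop 1
  rw [Filter.hasBasis_cocompact.eventually_iff] at h1
  obtain ⟨K, hK, hK1⟩ := h1
  obtain ⟨R, hR, hKR⟩ := hK.isBounded.subset_closedBall_lt 0 0
  set c := min (ε / 2) 1 with hc
  have hc0 : 0 < c := lt_min (by linarith) one_pos
  have hce : c ≤ ε / 2 := min_le_left _ _
  have hc1 : c ≤ 1 := min_le_right _ _
  set q : EuclideanSpace ℝ (Fin n) → ℝ := fun x => ‖gradient V x‖ ^ 2 / 2 - laplacian V x with hq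
  have cq : Continuous q := by fun_prop
  have cr : Continuous (fun x => c * (1 + ‖gradient V x‖ ^ 2) - q x) := by fun_prop
  obtain ⟨B, hB⟩ := ((isCompact_closedBall (0 : EuclideanSpace ℝ (Fin n)) R).image cr).bddAbove
  set C1 := max B 1 with hC1
  have hC10 : 0 < C1 := lt_of_lt_of_le one_pos (le_max_right _ _)
  have hpt : ∀ x, c * (1 + ‖gradient V x‖ ^ 2)
      ≤ q x + (Metric.closedBall 0 R).indicator (fun _ => C1) x := by
    intro x
    by_cases hx : x ∈ Metric.closedBall (0 : EuclideanSpace ℝ (Fin n)) R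
    · rw [indicator_of_mem hx]
      have := hB (mem_image_of_mem _ hx)
      have := le_max_left B 1
      linarith
    · rw [indicator_of_notMem hx]
      have := hK1 (show x ∈ Kᶜ from fun h => hx (hKR h))
      simp only [hq]
      have h3 := mul_le_mul_of_nonneg_right hce (sq_nonneg ‖gradient V x‖)
      linarith
  refine ⟨(2 + C1) / c, by positivity, R, hR, ?_⟩
  intro g hg hgc
  have cg := hg.continuous
  have hg2c : HasCompactSupport (fun x => g x ^ 2) :=
    hgc.comp_left (g := fun y : ℝ => y ^ 2) (by simp)
  have hcs : ∀ w : EuclideanSpace ℝ (Fin n) → ℝ, Continuous w → HasCompactSupport w →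
      Integrable w := fun w h1 h2 => h1.integrable_of_hasCompactSupport h2
  have hIntW : ∀ w : EuclideanSpace ℝ (Fin n) → ℝ, Continuous w →
      Integrable (fun x => g x ^ 2 * w x) := fun w hw =>
    hcs _ ((cg.pow 2).mul hw) hg2c.mul_right
  have hqle : ∫ x, g x ^ 2 * (Real.exp (-V x) * q x)
      ≤ 2 * ∫ x, (∑ i, (fderiv ℝ g x (EuclideanSpace.single i 1)) ^ 2) * Real.exp (-V x) := by
    have e1 : ∀ x, g x ^ 2 * (Real.exp (-V x) * q x) = ∑ i, g x ^ 2 * Real.exp (-V x) *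
        ((fderiv ℝ V x (EuclideanSpace.single i 1)) ^ 2 / 2
        - fderiv ℝ (fun y => fderiv ℝ V y (EuclideanSpace.single i 1)) x
          (EuclideanSpace.single i 1)) := by
      intro x
      rw [← Finset.mul_sum, Finset.sum_sub_distrib, ← Finset.sum_div, ← norm_gradient_sq]
      simp only [hq, laplacian]
      ring
    simp_rw [e1, Finset.sum_mul]
    rw [integral_finsetSum, integral_finsetSum, Finset.mul_sum]
    · exact Finset.sum_le_sum fun i _ => ibp_one hV hg hgc _
    · intro i _
      have hdgc : HasCompactSupport (fun x => fderiv ℝ g x (EuclideanSpace.single i 1)) :=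
        hgc.fderiv_apply (𝕜 := ℝ) _
      have := continuous_fderiv_apply_const hg (EuclideanSpace.single i 1)
      apply hcs _ (by fun_prop)
      apply HasCompactSupport.mul_right
      exact hdgc.comp_left (g := fun y : ℝ => y ^ 2) (by simp)
    · intro i _
      simp_rw [mul_assoc]
      apply hIntW
      have h1 := continuous_fderiv_apply_const hV1 (EuclideanSpace.single i 1)
      have h2 := continuous_fderiv_apply_const
        (contDiff_fderiv_apply_const hV (EuclideanSpace.single i 1)) (EuclideanSpace.single i 1)
      fun_prop
  have hS : 0 ≤ ∫ x, (∑ i, (fderiv ℝ g x (EuclideanSpace.single i 1)) ^ 2) * Real.exp (-V x) :=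
    integral_nonneg fun x => mul_nonneg (Finset.sum_nonneg fun i _ => sq_nonneg _)
      (Real.exp_pos _).le
  have hQ : 0 ≤ ∫ x in Metric.closedBall 0 R, g x ^ 2 * Real.exp (-V x) :=
    integral_nonneg fun x => mul_nonneg (sq_nonneg _) (Real.exp_pos _).le
  have main : c * ∫ x, g x ^ 2 * (1 + ‖gradient V x‖ ^ 2) * Real.exp (-V x)
      ≤ (∫ x, g x ^ 2 * (Real.exp (-V x) * q x))
        + C1 * ∫ x in Metric.closedBall 0 R, g x ^ 2 * Real.exp (-V x) := by
    rw [← integral_const_mul, ← integral_const_mul, ← integral_indicator (by measurability),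
      ← integral_add]
    · apply integral_mono
      · have := hIntW (fun x => c * ((1 + ‖gradient V x‖ ^ 2) * Real.exp (-V x))) (by fun_prop)
        refine this.congr (Eventually.of_forall fun x => ?_)
        simp only; ring
      · apply Integrable.add
        · exact hIntW _ (by fun_prop)
        · exact ((hIntW _ (by fun_prop)).const_mul C1).indicator (by measurability)
      · intro x
        have := mul_le_mul_of_nonneg_left (hpt x)
          (mul_nonneg (sq_nonneg (g x)) (Real.exp_pos (-V x)).le)
        by_cases hx : x ∈ Metric.closedBall (0 : EuclideanSpace ℝ (Fin n)) R
        · simp only [indicator_of_mem hx] at this ⊢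
          nlinarith
        · simp only [indicator_of_notMem hx] at this ⊢
          nlinarith
    · exact hIntW _ (by fun_prop)
    · exact ((hIntW _ (by fun_prop)).const_mul C1).indicator (by measurability)
  rw [div_mul_eq_mul_div, le_div_iff₀ hc0, mul_comm]
  nlinarith

/-- local square oscillation at scale `t` -/
noncomputable def osc {n : ℕ} (f : EuclideanSpace ℝ (Fin n) → ℝ) (t : ℝ)
    (x : EuclideanSpace ℝ (Fin n)) : ℝ :=
  ∫ z in Metric.closedBall (0 : EuclideanSpace ℝ (Fin n)) 1, (f (x - t • z) - f x) ^ 2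

lemma kernel_bound {n : ℕ} {ψ f : EuclideanSpace ℝ (Fin n) → ℝ} (hψ : Continuous ψ)
    (hψs : tsupport ψ ⊆ Metric.closedBall 0 1) (hf : Continuous f) (t : ℝ)
    (x : EuclideanSpace ℝ (Fin n)) :
    ((∫ z, ψ z * f (x - t • z)) - (∫ z, ψ z) * f x) ^ 2
      ≤ (∫ z in Metric.closedBall (0 : EuclideanSpace ℝ (Fin n)) 1, ψ z ^ 2) * osc f t x := by
  have hψc : HasCompactSupport ψ :=
    (isCompact_closedBall (0 : EuclideanSpace ℝ (Fin n)) 1).of_isClosed_subset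
      (isClosed_tsupport ψ) hψs
  have hcs : ∀ w : EuclideanSpace ℝ (Fin n) → ℝ, Continuous w → Integrable (fun z => ψ z * w z) :=
    fun w h1 => (hψ.mul h1).integrable_of_hasCompactSupport hψc.mul_right
  have hon : ∀ w : EuclideanSpace ℝ (Fin n) → ℝ, Continuous w →
      Integrable w (volume.restrict (Metric.closedBall (0 : EuclideanSpace ℝ (Fin n)) 1)) :=
    fun w h1 => h1.continuousOn.integrableOn_compact (isCompact_closedBall _ _)
  have e : (∫ z, ψ z * f (x - t • z)) - (∫ z, ψ z) * f x
      = ∫ z in Metric.closedBall (0 : EuclideanSpace ℝ (Fin n)) 1,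
          ψ z * (f (x - t • z) - f x) * 1 := by
    rw [setIntegral_eq_integral_of_forall_compl_eq_zero]
    · rw [← integral_mul_const, ← integral_sub (hcs _ (by fun_prop)) (hcs _ (by fun_prop))]
      congr 1; funext z; ring
    · intro z hz
      have : ψ z = 0 := image_eq_zero_of_notMem_tsupport fun h => hz (hψs h)
      simp [this]
  rw [e]
  have := cs_weighted (volume.restrict (Metric.closedBall (0 : EuclideanSpace ℝ (Fin n)) 1))
    ψ (fun z => f (x - t • z) - f x) (fun _ => 1) (fun _ => zero_le_one)
    (hon _ (by fun_prop)) (hon _ (by fun_prop)) (hon _ (by fun_prop))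
  simpa [osc] using this

lemma osc_nonneg {n : ℕ} (f : EuclideanSpace ℝ (Fin n) → ℝ) (t : ℝ)
    (x : EuclideanSpace ℝ (Fin n)) : 0 ≤ osc f t x :=
  integral_nonneg fun _ => sq_nonneg _

lemma mollify (n : ℕ) : ∃ C > (0:ℝ), ∀ f : EuclideanSpace ℝ (Fin n) → ℝ,
    Continuous f → HasCompactSupport f → ∀ t > (0:ℝ),
    ∃ g : EuclideanSpace ℝ (Fin n) → ℝ, ContDiff ℝ 1 g ∧ HasCompactSupport g ∧
      ∀ x, (g x - f x) ^ 2 ≤ C * osc f t x ∧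
        ∑ i, (fderiv ℝ g x (EuclideanSpace.single i 1)) ^ 2 ≤ C * (t⁻¹ ^ 2 * osc f t x) := by
  let b : ContDiffBump (0 : EuclideanSpace ℝ (Fin n)) := ⟨1/2, 1, by norm_num, by norm_num⟩
  set φ : EuclideanSpace ℝ (Fin n) → ℝ := b.normed volume with hφ
  have hφ1 : ContDiff ℝ 1 φ := b.contDiff_normed
  have hφs : tsupport φ ⊆ Metric.closedBall 0 1 := by
    rw [hφ, b.tsupport_normed_eq]
  have hφc : HasCompactSupport φ := b.hasCompactSupport_normed
  have hφi : ∫ z, φ z = 1 := b.integral_normed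
  set D : Fin n → EuclideanSpace ℝ (Fin n) → ℝ :=
    fun i z => fderiv ℝ φ z (EuclideanSpace.single i 1) with hD
  have cD : ∀ i, Continuous (D i) := fun i => continuous_fderiv_apply_const hφ1 _
  have hDs : ∀ i, tsupport (D i) ⊆ Metric.closedBall 0 1 := fun i =>
    (tsupport_fderiv_apply_subset ℝ _).trans hφs
  have hDi : ∀ i, ∫ z, D i z = 0 := by
    intro i
    have := integral_mul_fderiv_eq_neg_fderiv_mul_of_integrable
      (μ := (volume : Measure (EuclideanSpace ℝ (Fin n))))
      (f := fun _ => (1:ℝ)) (g := φ) (v := EuclideanSpace.single i 1)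
      (by simp)
      (by simpa using (cD i).integrable_of_hasCompactSupport (hφc.fderiv_apply (𝕜 := ℝ) _))
      (by simpa using hφ1.continuous.integrable_of_hasCompactSupport hφc)
      (fun x _ => differentiableAt_const _) (fun x _ => hφ1.differentiable (by norm_num) x)
    simpa using this
  set C0 := ∫ z in Metric.closedBall (0 : EuclideanSpace ℝ (Fin n)) 1, φ z ^ 2 with hC0
  have hC00 : 0 ≤ C0 := integral_nonneg fun _ => sq_nonneg _
  set C1 := ∑ i, ∫ z in Metric.closedBall (0 : EuclideanSpace ℝ (Fin n)) 1, D i z ^ 2 with hC1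
  have hC10 : 0 ≤ C1 := Finset.sum_nonneg fun i _ => integral_nonneg fun _ => sq_nonneg _
  refine ⟨C0 + C1 + 1, by positivity, ?_⟩
  intro f cf hfc t ht
  set F : EuclideanSpace ℝ (Fin n) → ℝ := fun u => f (t • u) with hF
  have cF : Continuous F := by fun_prop
  have hFc : HasCompactSupport F := hfc.comp_smul ht.ne'
  set h := convolution φ F (ContinuousLinearMap.mul ℝ ℝ) volume with hh
  have hh1 : ContDiff ℝ 1 h := hφc.contDiff_convolution_left _ hφ1 cF.locallyIntegrable
  have hhc : HasCompactSupport h := hφc.convolution _ hFc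
  have hsc : ∀ (x z : EuclideanSpace ℝ (Fin n)), t • (t⁻¹ • x - z) = x - t • z := by
    intro x z
    rw [smul_sub, smul_inv_smul₀ ht.ne']
  refine ⟨fun x => h (t⁻¹ • x), hh1.comp (contDiff_const_smul _),
    hhc.comp_smul (inv_ne_zero ht.ne'), fun x => ⟨?_, ?_⟩⟩
  · have h1 := kernel_bound hφ1.continuous hφs cf t x
    have e : h (t⁻¹ • x) = ∫ z, φ z * f (x - t • z) := by
      simp only [hh, convolution, ContinuousLinearMap.mul_apply', hF, hsc]
    rw [hφi, one_mul, ← e] at h1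
    have := osc_nonneg f t x
    exact h1.trans (by gcongr; linarith)
  · have hd : ∀ i, fderiv ℝ (fun x => h (t⁻¹ • x)) x (EuclideanSpace.single i 1)
        = t⁻¹ * ∫ z, D i z * f (x - t • z) := by
      intro i
      have h0 : HasFDerivAt h _ (t⁻¹ • x) := hφc.hasFDerivAt_convolution_left
        (ContinuousLinearMap.mul ℝ ℝ) hφ1 cF.locallyIntegrable (t⁻¹ • x)
      have h1 := h0.comp x ((hasFDerivAt_id x).const_smul t⁻¹)
      have h2 : fderiv ℝ (fun x => h (t⁻¹ • x)) x = _ := h1.fderiv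
      rw [h2]
      have hex := (hφc.fderiv ℝ).convolutionExists_left
        ((ContinuousLinearMap.mul ℝ ℝ).precompL (EuclideanSpace ℝ (Fin n)))
        (hφ1.continuous_fderiv (by norm_num)) (cF.locallyIntegrable (μ := volume)) (t⁻¹ • x)
      simp only [ContinuousLinearMap.comp_apply, smul_apply,
        ContinuousLinearMap.id_apply, map_smul, smul_eq_mul]
      congr 1
      rw [convolution, ContinuousLinearMap.integral_apply hex]
      congr 1
      funext z
      simp [hF, hsc, hD, ContinuousLinearMap.precompL_apply]
    have h3 : ∀ i, (fderiv ℝ (fun x => h (t⁻¹ • x)) x (EuclideanSpace.single i 1)) ^ 2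
        ≤ (∫ z in Metric.closedBall (0 : EuclideanSpace ℝ (Fin n)) 1, D i z ^ 2)
          * (t⁻¹ ^ 2 * osc f t x) := by
      intro i
      have h1 := kernel_bound (cD i) (hDs i) cf t x
      rw [hDi, zero_mul, sub_zero] at h1
      rw [hd, mul_pow]
      have := mul_le_mul_of_nonneg_left h1 (sq_nonneg t⁻¹)
      linarith
    calc _ ≤ ∑ i, (∫ z in Metric.closedBall (0 : EuclideanSpace ℝ (Fin n)) 1, D i z ^ 2)
          * (t⁻¹ ^ 2 * osc f t x) := Finset.sum_le_sum fun i _ => h3 i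
      _ = C1 * (t⁻¹ ^ 2 * osc f t x) := by rw [← Finset.sum_mul]
      _ ≤ _ := by
        have := mul_nonneg (sq_nonneg t⁻¹) (osc_nonneg f t x)
        gcongr; linarith

lemma osc_integrable {n : ℕ} {f w : EuclideanSpace ℝ (Fin n) → ℝ} (hf : Continuous f)
    (hfc : HasCompactSupport f) (hw : Integrable w) (t : ℝ) :
    Integrable (fun x => osc f t x * w x) := by
  obtain ⟨B, hB⟩ := hfc.exists_bound_of_continuous hf
  have hc : Continuous (fun x => osc f t x) := by
    unfold osc
    apply continuous_parametric_integral_of_continuous (by fun_prop) (isCompact_closedBall _ _)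
  refine hw.bdd_mul (c := (2 * B) ^ 2 * volume.real
    (Metric.closedBall (0 : EuclideanSpace ℝ (Fin n)) 1)) hc.aestronglyMeasurable ?_
  refine Eventually.of_forall fun x => ?_
  apply norm_setIntegral_le_of_norm_le_const (isCompact_closedBall _ _).measure_lt_top
  intro z _
  rw [norm_pow]
  gcongr
  have h1 := hB (x - t • z)
  have h2 := hB x
  calc _ ≤ _ := norm_sub_le _ _
    _ ≤ _ := by linarith

set_option maxHeartbeats 2000000 in
lemma scale_bound {n : ℕ} {V : EuclideanSpace ℝ (Fin n) → ℝ}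
    (hV : ContDiff ℝ 2 V) (hMint : Integrable (fun x => Real.exp (-V x)))
    (hconf : ∃ ε > (0:ℝ), Tendsto
      (fun x => (1 - ε) * ‖gradient V x‖ ^ 2 / 2 - laplacian V x)
      (cocompact (EuclideanSpace ℝ (Fin n))) atTop) :
    ∃ C > (0:ℝ), ∃ R > (0:ℝ), ∀ f : EuclideanSpace ℝ (Fin n) → ℝ,
      Continuous f → HasCompactSupport f → ∀ t ∈ Ioc (0:ℝ) 1,
      ∫ x, f x ^ 2 * Real.exp (-V x) * min (1 + ‖gradient V x‖ ^ 2) (t⁻¹ ^ 2)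
        ≤ C * (t⁻¹ ^ 2 * (∫ x, osc f t x * Real.exp (-V x))
          + ∫ x in Metric.closedBall 0 R, f x ^ 2 * Real.exp (-V x)) := by
  obtain ⟨CP, hCP, R, hR, hP⟩ := weighted_poincare hV hconf
  obtain ⟨Cm, hCm, hmol⟩ := mollify n
  refine ⟨6 * CP * Cm + 4 * CP + 2 * Cm, by positivity, R, hR, ?_⟩
  intro f cf hfc t ht
  obtain ⟨g, hg, hgc, hgb⟩ := hmol f cf hfc t ht.1
  have hP := hP g hg hgc
  have hV1 : ContDiff ℝ 1 V := hV.of_le (by norm_num)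
  have cV := hV.continuous
  have cG : Continuous (fun x => ‖gradient V x‖ ^ 2) := by
    simp_rw [norm_gradient_sq]
    exact continuous_finsetSum _ fun i _ => (continuous_fderiv_apply_const hV1 _).pow 2
  have cg := hg.continuous
  have hs : 1 ≤ t⁻¹ ^ 2 := by
    have : 1 ≤ t⁻¹ := (one_le_inv₀ ht.1).2 ht.2
    nlinarith
  set s := t⁻¹ ^ 2 with hsdef
  have hgi : ∀ w : EuclideanSpace ℝ (Fin n) → ℝ, Continuous w →
      Integrable (fun x => g x ^ 2 * w x) := fun w hw =>
    Continuous.integrable_of_hasCompactSupport (by fun_prop)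
      (HasCompactSupport.mul_right (hgc.comp_left (g := fun y : ℝ => y ^ 2) (by simp)))
  have hfi : ∀ w : EuclideanSpace ℝ (Fin n) → ℝ, Continuous w →
      Integrable (fun x => f x ^ 2 * w x) := fun w hw =>
    Continuous.integrable_of_hasCompactSupport (by fun_prop)
      (HasCompactSupport.mul_right (hfc.comp_left (g := fun y : ℝ => y ^ 2) (by simp)))
  have hO := osc_integrable cf hfc hMint t
  set O := ∫ x, osc f t x * Real.exp (-V x) with hOdef
  have hO0 : 0 ≤ O := integral_nonneg fun x => mul_nonneg (osc_nonneg _ _ _) (Real.exp_pos _).le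
  set Q := ∫ x in Metric.closedBall 0 R, f x ^ 2 * Real.exp (-V x) with hQdef
  have hQ0 : 0 ≤ Q := integral_nonneg fun x => mul_nonneg (sq_nonneg _) (Real.exp_pos _).le
  have h1 : ∫ x, f x ^ 2 * Real.exp (-V x) * min (1 + ‖gradient V x‖ ^ 2) s
      ≤ 2 * (∫ x, g x ^ 2 * (1 + ‖gradient V x‖ ^ 2) * Real.exp (-V x)) + 2 * s * Cm * O := by
    rw [hOdef, ← integral_const_mul, ← integral_const_mul, ← integral_add]
    · apply integral_mono
      · simp_rw [mul_assoc]; exact hfi _ (by fun_prop)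
      · apply Integrable.add
        · simp_rw [mul_assoc]; exact (hgi _ (by fun_prop)).const_mul 2
        · exact hO.const_mul _
      · intro x
        have he := Real.exp_pos (-V x)
        simp only
        have a1 := (hgb x).1
        have a2 : f x ^ 2 ≤ 2 * g x ^ 2 + 2 * (g x - f x) ^ 2 := by
          nlinarith [sq_nonneg (2 * g x - f x)]
        have hm1 := min_le_left (1 + ‖gradient V x‖ ^ 2) s
        have hm2 := min_le_right (1 + ‖gradient V x‖ ^ 2) s
        have hm0 : 0 ≤ min (1 + ‖gradient V x‖ ^ 2) s := by
          apply le_min <;> positivity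
        have a3 : f x ^ 2 * min (1 + ‖gradient V x‖ ^ 2) s
            ≤ 2 * (g x ^ 2 * (1 + ‖gradient V x‖ ^ 2)) + 2 * (Cm * osc f t x * s) := by
          calc _ ≤ (2 * g x ^ 2 + 2 * (g x - f x) ^ 2) * min (1 + ‖gradient V x‖ ^ 2) s := by
                gcongr
            _ = 2 * (g x ^ 2 * min (1 + ‖gradient V x‖ ^ 2) s)
                + 2 * ((g x - f x) ^ 2 * min (1 + ‖gradient V x‖ ^ 2) s) := by ring
            _ ≤ _ := by
              have := osc_nonneg f t x
              gcongr
        linarith [mul_le_mul_of_nonneg_right a3 he.le]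
    · simp_rw [mul_assoc]; exact (hgi _ (by fun_prop)).const_mul 2
    · exact hO.const_mul _
  have h2 : ∫ x, (∑ i, (fderiv ℝ g x (EuclideanSpace.single i 1)) ^ 2) * Real.exp (-V x)
      ≤ Cm * s * O := by
    rw [hOdef, ← integral_const_mul]
    apply integral_mono_of_nonneg
    · exact Eventually.of_forall fun x => mul_nonneg (Finset.sum_nonneg fun i _ => sq_nonneg _)
        (Real.exp_pos _).le
    · exact hO.const_mul _
    · refine Eventually.of_forall fun x => ?_
      have := mul_le_mul_of_nonneg_right (hgb x).2 (Real.exp_pos (-V x)).le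
      simp only
      linarith
  have h3 : ∫ x in Metric.closedBall 0 R, g x ^ 2 * Real.exp (-V x) ≤ 2 * Cm * O + 2 * Q := by
    have : ∫ x in Metric.closedBall 0 R, g x ^ 2 * Real.exp (-V x)
        ≤ ∫ x in Metric.closedBall 0 R, (2 * Cm * (osc f t x * Real.exp (-V x))
          + 2 * (f x ^ 2 * Real.exp (-V x))) := by
      apply integral_mono
      · exact (hgi _ (by fun_prop)).integrableOn
      · exact ((hO.const_mul _).add ((hfi _ (by fun_prop)).const_mul 2)).integrableOn
      · intro x
        have he := Real.exp_pos (-V x)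
        have a1 := (hgb x).1
        have a2 : g x ^ 2 ≤ 2 * (Cm * osc f t x) + 2 * f x ^ 2 := by
          nlinarith [sq_nonneg (2 * f x - g x)]
        simp only
        linarith [mul_le_mul_of_nonneg_right a2 he.le]
    rw [integral_add (hO.const_mul _).integrableOn
      ((hfi _ (by fun_prop)).const_mul 2).integrableOn, integral_const_mul, integral_const_mul] at this
    have h4 : ∫ x in Metric.closedBall 0 R, osc f t x * Real.exp (-V x) ≤ O :=
      setIntegral_le_integral hO (Eventually.of_forall fun x =>
        mul_nonneg (osc_nonneg _ _ _) (Real.exp_pos _).le)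
    have := mul_le_mul_of_nonneg_left h4 (by positivity : 0 ≤ 2 * Cm)
    linarith
  have h5 : O ≤ s * O := le_mul_of_one_le_left hO0 hs
  have hP2 := hP.trans (mul_le_mul_of_nonneg_left (add_le_add h2 h3) hCP.le)
  have h6 := mul_le_mul_of_nonneg_left h5 (by positivity : 0 ≤ 4 * CP * Cm)
  have h7 : 0 ≤ CP * (s * O) := by positivity
  have h8 : 0 ≤ CP * Cm * Q := by positivity
  have h9 : 0 ≤ Cm * Q := by positivity
  linarith

lemma one_dim_lower {α W : ℝ} (hα : α ∈ Ioo (0:ℝ) 2) (hW : 1 ≤ W) :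
    ENNReal.ofReal (W ^ (α / 2) / (2 - α))
      ≤ ∫⁻ t in Ioc (0:ℝ) 1, ENNReal.ofReal (t ^ (1 - α) * min W (t⁻¹ ^ 2)) := by
  obtain ⟨h0, h2⟩ := hα
  have hW0 : 0 < W := by linarith
  set r := W ^ (-(1/2) : ℝ) with hr
  have hr0 : 0 < r := Real.rpow_pos_of_pos hW0 _
  have hr1 : r ≤ 1 := Real.rpow_le_one_of_one_le_of_nonpos hW (by norm_num)
  have hrW : r⁻¹ ^ 2 = W := by
    rw [hr, Real.rpow_neg hW0.le, inv_inv, ← Real.sqrt_eq_rpow, Real.sq_sqrt hW0.le]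
  calc ENNReal.ofReal (W ^ (α / 2) / (2 - α))
      = ENNReal.ofReal (∫ t in Ioc 0 r, t ^ (1 - α) * W) := by
        congr 1
        rw [← intervalIntegral.integral_of_le hr0.le, intervalIntegral.integral_mul_const,
          integral_rpow (Or.inl (by linarith))]
        rw [Real.zero_rpow (by linarith), sub_zero, hr, ← Real.rpow_mul hW0.le]
        rw [show 1 - α + 1 = 2 - α by ring, div_mul_eq_mul_div]
        congr 1
        nth_rw 3 [← Real.rpow_one W]
        rw [← Real.rpow_add hW0]
        congr 1; ring
    _ = ∫⁻ t in Ioc 0 r, ENNReal.ofReal (t ^ (1 - α) * W) := by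
        apply ofReal_integral_eq_lintegral_ofReal
        · rw [← IntegrableOn, ← intervalIntegrable_iff_integrableOn_Ioc_of_le hr0.le]
          exact (intervalIntegral.intervalIntegrable_rpow' (by linarith)).mul_const W
        · filter_upwards [ae_restrict_mem measurableSet_Ioc] with t ht
          have := ht.1
          positivity
    _ ≤ ∫⁻ t in Ioc 0 r, ENNReal.ofReal (t ^ (1 - α) * min W (t⁻¹ ^ 2)) := by
        apply setLIntegral_mono' measurableSet_Ioc
        intro t ht
        have : W ≤ t⁻¹ ^ 2 := by
          rw [← hrW]
          have := inv_anti₀ ht.1 ht.2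
          gcongr
        rw [min_eq_left this]
    _ ≤ _ := lintegral_mono_set (Ioc_subset_Ioc_right hr1)

lemma one_dim_upper {p r : ℝ} (hp : 0 < p) (hr : 0 < r) :
    ∫⁻ t in Ioi r, ENNReal.ofReal (t ^ (-1 - p)) = ENNReal.ofReal (r ^ (-p) / p) := by
  rw [← ofReal_integral_eq_lintegral_ofReal]
  · rw [integral_Ioi_rpow_of_lt (by linarith) hr]
    congr 1
    rw [show -1 - p + 1 = -p by ring, neg_div_neg_eq]
  · exact integrableOn_Ioi_rpow_of_lt (by linarith) hr
  · filter_upwards [ae_restrict_mem measurableSet_Ioi] with t ht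
    have : 0 < t := hr.trans ht
    positivity

/-- the fractional energy, as an extended real -/
noncomputable def energy {n : ℕ} (α : ℝ) (V f : EuclideanSpace ℝ (Fin n) → ℝ) : ENNReal :=
  ∫⁻ x, ∫⁻ y, ENNReal.ofReal (|f x - f y| ^ 2 / ‖x - y‖ ^ ((n : ℝ) + α)
            * (Real.exp (-V x) * Real.exp (-1 * ‖x - y‖)))

lemma lintegral_ball_smul {n : ℕ} (G : EuclideanSpace ℝ (Fin n) → ENNReal) (hG : Measurable G)
    {t : ℝ} (ht : 0 < t) :
    ∫⁻ z in Metric.closedBall (0 : EuclideanSpace ℝ (Fin n)) 1, G (t • z)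
      = ENNReal.ofReal (t ^ (-(n : ℝ))) * ∫⁻ y, (if ‖y‖ ≤ t then G y else 0) := by
  have hset : MeasurableSet {y : EuclideanSpace ℝ (Fin n) | ‖y‖ ≤ t} :=
    measurableSet_le measurable_norm measurable_const
  have hm : Measurable (fun y : EuclideanSpace ℝ (Fin n) => if ‖y‖ ≤ t then G y else 0) :=
    Measurable.ite hset hG measurable_const
  have h1 : ∫⁻ z in Metric.closedBall (0 : EuclideanSpace ℝ (Fin n)) 1, G (t • z)
      = ∫⁻ z : EuclideanSpace ℝ (Fin n), (fun y => if ‖y‖ ≤ t then G y else 0) (t • z) := by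
    rw [← lintegral_indicator Metric.isClosed_closedBall.measurableSet]
    congr 1
    funext z
    have : ‖t • z‖ ≤ t ↔ z ∈ Metric.closedBall (0 : EuclideanSpace ℝ (Fin n)) 1 := by
      rw [norm_smul, Real.norm_of_nonneg ht.le, mem_closedBall_zero_iff]
      constructor
      · intro h; nlinarith
      · intro h; nlinarith
    by_cases hz : z ∈ Metric.closedBall (0 : EuclideanSpace ℝ (Fin n)) 1
    · simp only [indicator_of_mem hz, this.2 hz, if_true]
    · simp only [indicator_of_notMem hz, mt this.1 hz, if_false]
  rw [h1, ← lintegral_map hm (measurable_const_smul t), Measure.map_addHaar_smul _ ht.ne',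
    lintegral_smul_measure]
  simp only [finrank_euclideanSpace, Fintype.card_fin, smul_eq_mul]
  congr 2
  rw [abs_of_nonneg (by positivity), Real.rpow_neg ht.le, Real.rpow_natCast]

lemma inner_bound {n : ℕ} {α : ℝ} (hα : 0 < α) (f : EuclideanSpace ℝ (Fin n) → ℝ)
    (hf : Continuous f) (x : EuclideanSpace ℝ (Fin n)) :
    ∫⁻ t in Ioc (0:ℝ) 1, ENNReal.ofReal (t ^ (-1 - α)) *
        ∫⁻ z in Metric.closedBall (0 : EuclideanSpace ℝ (Fin n)) 1,
          ENNReal.ofReal ((f (x - t • z) - f x) ^ 2)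
      ≤ ENNReal.ofReal (Real.exp 1 / (n + α)) *
        ∫⁻ y, ENNReal.ofReal (|f x - f y| ^ 2 / ‖x - y‖ ^ ((n : ℝ) + α)
            * Real.exp (-1 * ‖x - y‖)) := by
  set G : EuclideanSpace ℝ (Fin n) → ENNReal := fun y => ENNReal.ofReal ((f (x - y) - f x) ^ 2)
    with hGdef
  have hG : Measurable G := by
    apply ENNReal.measurable_ofReal.comp
    exact Continuous.measurable (by fun_prop)
  have hp : 0 < (n : ℝ) + α := by positivity
  calc _ = ∫⁻ t in Ioc (0:ℝ) 1, ∫⁻ y, ENNReal.ofReal (t ^ (-1 - ((n : ℝ) + α))) *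
            (if ‖y‖ ≤ t then G y else 0) := by
        apply setLIntegral_congr_fun measurableSet_Ioc
        intro t ht
        simp only
        rw [lintegral_const_mul _
          (Measurable.ite (measurableSet_le measurable_norm measurable_const) hG measurable_const)]
        rw [lintegral_ball_smul G hG ht.1, ← mul_assoc, ← ENNReal.ofReal_mul (by
          have := ht.1; positivity), ← Real.rpow_add ht.1]
        congr 3; ring
    _ = ∫⁻ y, ∫⁻ t in Ioc (0:ℝ) 1, ENNReal.ofReal (t ^ (-1 - ((n : ℝ) + α))) *
            (if ‖y‖ ≤ t then G y else 0) := by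
        apply lintegral_lintegral_swap
        apply Measurable.aemeasurable
        apply Measurable.mul
        · exact ENNReal.measurable_ofReal.comp (measurable_fst.pow_const _)
        · exact Measurable.ite (measurableSet_le (measurable_norm.comp measurable_snd)
            measurable_fst) (hG.comp measurable_snd) measurable_const
    _ ≤ ∫⁻ y, ENNReal.ofReal (Real.exp 1 / (n + α)) *
          ENNReal.ofReal (|f x - f (x - y)| ^ 2 / ‖x - (x - y)‖ ^ ((n : ℝ) + α)
            * Real.exp (-1 * ‖x - (x - y)‖)) := by
        apply lintegral_mono
        intro y
        simp only [sub_sub_cancel]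
        rcases eq_or_ne y 0 with rfl | hy
        · simp [hGdef]
        have hy0 : 0 < ‖y‖ := norm_pos_iff.2 hy
        have hind : ∫⁻ t in Ioc (0:ℝ) 1, ENNReal.ofReal (t ^ (-1 - ((n : ℝ) + α))) *
            (if ‖y‖ ≤ t then G y else 0)
            ≤ (if ‖y‖ ≤ 1 then ENNReal.ofReal (‖y‖ ^ (-((n : ℝ) + α)) / (n + α)) else 0) * G y := by
          by_cases hy1 : ‖y‖ ≤ 1
          · rw [if_pos hy1, ← one_dim_upper hp hy0, ← lintegral_mul_const'' _ (by
              apply Measurable.aemeasurable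
              exact ENNReal.measurable_ofReal.comp (measurable_id.pow_const _)),
              setLIntegral_congr (Ioi_ae_eq_Ici (a := ‖y‖)),
              ← lintegral_indicator measurableSet_Ioc, ← lintegral_indicator measurableSet_Ici]
            apply lintegral_mono
            intro t
            by_cases ht : t ∈ Ioc (0:ℝ) 1
            · by_cases ht2 : ‖y‖ ≤ t
              · simp [indicator, ht, ht2]
              · simp [indicator, ht2]
            · simp [indicator, ht]
          · rw [if_neg hy1, zero_mul, nonpos_iff_eq_zero]
            rw [setLIntegral_congr_fun measurableSet_Ioc (g := fun _ => 0)]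
            · simp
            · intro t ht
              have : ¬ ‖y‖ ≤ t := fun h => hy1 (h.trans ht.2)
              simp [this]
        refine hind.trans ?_
        by_cases hy1 : ‖y‖ ≤ 1
        · rw [if_pos hy1, ← ENNReal.ofReal_mul (by positivity), ← ENNReal.ofReal_mul (by positivity)]
          apply ENNReal.ofReal_le_ofReal
          rw [Real.rpow_neg hy0.le, sq_abs]
          have he : 1 ≤ Real.exp 1 * Real.exp (-1 * ‖y‖) := by
            rw [← Real.exp_add]; apply Real.one_le_exp; linarith
          have hr : 0 < ‖y‖ ^ ((n : ℝ) + α) := by positivity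
          have : 0 ≤ (‖y‖ ^ ((n : ℝ) + α))⁻¹ / (n + α) * (f (x - y) - f x) ^ 2 := by positivity
          calc _ ≤ (‖y‖ ^ ((n : ℝ) + α))⁻¹ / (n + α) * (f (x - y) - f x) ^ 2
                * (Real.exp 1 * Real.exp (-1 * ‖y‖)) := le_mul_of_one_le_right this he
            _ = _ := by rw [show (f x - f (x - y)) ^ 2 = (f (x - y) - f x) ^ 2 by ring]; ring
        · simp [hy1]
    _ = _ := by
        rw [lintegral_const_mul' _ _ ENNReal.ofReal_ne_top]
        congr 1
        exact lintegral_sub_left_eq_self (fun y => ENNReal.ofReal (|f x - f y| ^ 2 /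
          ‖x - y‖ ^ ((n : ℝ) + α) * Real.exp (-1 * ‖x - y‖))) x

lemma osc_energy {n : ℕ} {α : ℝ} (hα : 0 < α) (V f : EuclideanSpace ℝ (Fin n) → ℝ)
    (hV : Continuous V) (hf : Continuous f) (hfc : HasCompactSupport f)
    (hMint : Integrable (fun x => Real.exp (-V x))) :
    ∫⁻ t in Ioc (0:ℝ) 1, ENNReal.ofReal (t ^ (-1 - α) * ∫ x, osc f t x * Real.exp (-V x))
      ≤ ENNReal.ofReal (Real.exp 1 / (n + α)) * energy α V f := by
  have hmeas3 : Measurable (fun p : (ℝ × EuclideanSpace ℝ (Fin n)) × EuclideanSpace ℝ (Fin n) =>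
      ENNReal.ofReal ((f (p.1.2 - p.1.1 • p.2) - f p.1.2) ^ 2)) := by
    apply ENNReal.measurable_ofReal.comp
    exact Continuous.measurable (by fun_prop)
  calc _ = ∫⁻ t in Ioc (0:ℝ) 1, ∫⁻ x, ENNReal.ofReal (t ^ (-1 - α)) * (ENNReal.ofReal (Real.exp (-V x)) *
          ∫⁻ z in Metric.closedBall (0 : EuclideanSpace ℝ (Fin n)) 1,
          ENNReal.ofReal ((f (x - t • z) - f x) ^ 2)) := by
        apply setLIntegral_congr_fun measurableSet_Ioc
        intro t ht
        simp only
        rw [ENNReal.ofReal_mul (by have := ht.1; positivity),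
          lintegral_const_mul' _ _ ENNReal.ofReal_ne_top]
        congr 1
        rw [ofReal_integral_eq_lintegral_ofReal (osc_integrable hf hfc hMint t)
          (Eventually.of_forall fun x => mul_nonneg (osc_nonneg _ _ _) (Real.exp_pos _).le)]
        congr 1
        funext x
        rw [ENNReal.ofReal_mul (osc_nonneg _ _ _), mul_comm]
        congr 1
        unfold osc
        rw [ofReal_integral_eq_lintegral_ofReal]
        · exact ContinuousOn.integrableOn_compact (isCompact_closedBall _ _)
            (Continuous.continuousOn (by fun_prop))
        · exact Eventually.of_forall fun z => sq_nonneg _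
    _ = ∫⁻ x, ∫⁻ t in Ioc (0:ℝ) 1, ENNReal.ofReal (t ^ (-1 - α)) * (ENNReal.ofReal (Real.exp (-V x)) *
          ∫⁻ z in Metric.closedBall (0 : EuclideanSpace ℝ (Fin n)) 1,
          ENNReal.ofReal ((f (x - t • z) - f x) ^ 2)) := by
        apply lintegral_lintegral_swap
        apply Measurable.aemeasurable
        apply Measurable.mul
        · exact ENNReal.measurable_ofReal.comp (measurable_fst.pow_const _)
        apply Measurable.mul
        · apply ENNReal.measurable_ofReal.comp
          exact Continuous.measurable (by fun_prop)
        · exact hmeas3.lintegral_prod_right'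
    _ ≤ ∫⁻ x, ENNReal.ofReal (Real.exp (-V x)) * (ENNReal.ofReal (Real.exp 1 / (n + α)) *
        ∫⁻ y, ENNReal.ofReal (|f x - f y| ^ 2 / ‖x - y‖ ^ ((n : ℝ) + α)
            * Real.exp (-1 * ‖x - y‖))) := by
        apply lintegral_mono
        intro x
        simp only
        have : ∀ t : ℝ, ENNReal.ofReal (t ^ (-1 - α)) * (ENNReal.ofReal (Real.exp (-V x)) *
          ∫⁻ z in Metric.closedBall (0 : EuclideanSpace ℝ (Fin n)) 1,
          ENNReal.ofReal ((f (x - t • z) - f x) ^ 2)) = ENNReal.ofReal (Real.exp (-V x)) *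
          (ENNReal.ofReal (t ^ (-1 - α)) *
          ∫⁻ z in Metric.closedBall (0 : EuclideanSpace ℝ (Fin n)) 1,
          ENNReal.ofReal ((f (x - t • z) - f x) ^ 2)) := fun t => by ring
        simp_rw [this]
        rw [lintegral_const_mul' _ _ ENNReal.ofReal_ne_top]
        gcongr
        exact inner_bound hα f hf x
    _ = _ := by
        unfold energy
        rw [← lintegral_const_mul' _ _ ENNReal.ofReal_ne_top]
        congr 1
        funext x
        rw [mul_left_comm, ← lintegral_const_mul' _ _ ENNReal.ofReal_ne_top]
        congr 2
        funext y
        rw [← ENNReal.ofReal_mul (Real.exp_pos _).le]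
        congr 1; ring

lemma frac_bound {n : ℕ} {V : EuclideanSpace ℝ (Fin n) → ℝ}
    (hV : ContDiff ℝ 2 V) (hMint : Integrable (fun x => Real.exp (-V x)))
    (hconf : ∃ ε > (0:ℝ), Tendsto
      (fun x => (1 - ε) * ‖gradient V x‖ ^ 2 / 2 - laplacian V x)
      (cocompact (EuclideanSpace ℝ (Fin n))) atTop)
    {α : ℝ} (hα : α ∈ Ioo (0:ℝ) 2) :
    ∃ C > (0:ℝ), ∃ R > (0:ℝ), ∀ f : EuclideanSpace ℝ (Fin n) → ℝ,
      Continuous f → HasCompactSupport f →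
      ENNReal.ofReal (∫ x, f x ^ 2 * Real.exp (-V x) * (1 + ‖gradient V x‖ ^ 2) ^ (α / 2))
        ≤ ENNReal.ofReal C * (energy α V f +
          ENNReal.ofReal (∫ x in Metric.closedBall 0 R, f x ^ 2 * Real.exp (-V x))) := by
  obtain ⟨C, hC, R, hR, hS⟩ := scale_bound hV hMint hconf
  obtain ⟨h0, h2⟩ := hα
  have h2' : 0 < 2 - α := by linarith
  set c1 := Real.exp 1 / (n + α) with hc1
  have hc10 : 0 < c1 := by positivity
  have hV1 : ContDiff ℝ 1 V := hV.of_le (by norm_num)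
  have cV := hV.continuous
  have cG : Continuous (fun x => ‖gradient V x‖ ^ 2) := by
    simp_rw [norm_gradient_sq]
    exact continuous_finsetSum _ fun i _ => (continuous_fderiv_apply_const hV1 _).pow 2
  refine ⟨(2 - α) * C * (c1 + (2 - α)⁻¹), by positivity, R, hR, ?_⟩
  intro f cf hfc
  set Q := ∫ x in Metric.closedBall 0 R, f x ^ 2 * Real.exp (-V x) with hQdef
  have hQ0 : 0 ≤ Q := integral_nonneg fun x => mul_nonneg (sq_nonneg _) (Real.exp_pos _).le
  have hfi : ∀ w : EuclideanSpace ℝ (Fin n) → ℝ, Continuous w →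
      Integrable (fun x => f x ^ 2 * Real.exp (-V x) * w x) := fun w hw =>
    Continuous.integrable_of_hasCompactSupport (by fun_prop)
      (HasCompactSupport.mul_right (HasCompactSupport.mul_right
        (hfc.comp_left (g := fun y : ℝ => y ^ 2) (by simp))))
  have hcont : Continuous (fun x => (1 + ‖gradient V x‖ ^ 2) ^ (α / 2)) :=
    (continuous_const.add cG).rpow_const fun x => Or.inr (by positivity)
  -- the power integral
  have hpow : ∫⁻ t in Ioc (0:ℝ) 1, ENNReal.ofReal (t ^ (1 - α)) = ENNReal.ofReal (2 - α)⁻¹ := by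
    rw [← ofReal_integral_eq_lintegral_ofReal]
    · rw [← intervalIntegral.integral_of_le zero_le_one, integral_rpow (Or.inl (by linarith))]
      rw [Real.zero_rpow (by linarith), Real.one_rpow, sub_zero, one_div]
      congr 2; ring
    · rw [← IntegrableOn, ← intervalIntegrable_iff_integrableOn_Ioc_of_le zero_le_one]
      exact intervalIntegral.intervalIntegrable_rpow' (by linarith)
    · filter_upwards [ae_restrict_mem measurableSet_Ioc] with t ht
      have := ht.1
      positivity
  have key : ENNReal.ofReal ((2 - α)⁻¹) *
      ENNReal.ofReal (∫ x, f x ^ 2 * Real.exp (-V x) * (1 + ‖gradient V x‖ ^ 2) ^ (α / 2))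
      ≤ ENNReal.ofReal C * (ENNReal.ofReal c1 * energy α V f
        + ENNReal.ofReal (2 - α)⁻¹ * ENNReal.ofReal Q) := by
    calc _ = ∫⁻ x, ENNReal.ofReal (f x ^ 2 * Real.exp (-V x)) *
            ENNReal.ofReal ((1 + ‖gradient V x‖ ^ 2) ^ (α / 2) / (2 - α)) := by
          rw [ofReal_integral_eq_lintegral_ofReal (hfi _ hcont)
            (Eventually.of_forall fun x => by positivity),
            ← lintegral_const_mul' _ _ ENNReal.ofReal_ne_top]
          congr 1; funext x
          rw [← ENNReal.ofReal_mul (by positivity), ← ENNReal.ofReal_mul (by positivity)]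
          congr 1; field_simp
      _ ≤ ∫⁻ x, ENNReal.ofReal (f x ^ 2 * Real.exp (-V x)) *
            ∫⁻ t in Ioc (0:ℝ) 1, ENNReal.ofReal (t ^ (1 - α) *
              min (1 + ‖gradient V x‖ ^ 2) (t⁻¹ ^ 2)) := by
          apply lintegral_mono
          intro x
          simp only
          gcongr
          exact one_dim_lower ⟨h0, h2⟩ (by nlinarith [sq_nonneg ‖gradient V x‖])
      _ = ∫⁻ x, ∫⁻ t in Ioc (0:ℝ) 1, ENNReal.ofReal (f x ^ 2 * Real.exp (-V x)) *
            ENNReal.ofReal (t ^ (1 - α) * min (1 + ‖gradient V x‖ ^ 2) (t⁻¹ ^ 2)) := by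
          congr 1; funext x
          rw [lintegral_const_mul' _ _ ENNReal.ofReal_ne_top]
      _ = ∫⁻ t in Ioc (0:ℝ) 1, ∫⁻ x, ENNReal.ofReal (f x ^ 2 * Real.exp (-V x)) *
            ENNReal.ofReal (t ^ (1 - α) * min (1 + ‖gradient V x‖ ^ 2) (t⁻¹ ^ 2)) := by
          apply lintegral_lintegral_swap
          apply Measurable.aemeasurable
          have m1 : Measurable (fun p : EuclideanSpace ℝ (Fin n) × ℝ =>
              ENNReal.ofReal (f p.1 ^ 2 * Real.exp (-V p.1))) := by
            apply ENNReal.measurable_ofReal.comp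
            exact Continuous.measurable (by fun_prop)
          have m2 : Measurable (fun p : EuclideanSpace ℝ (Fin n) × ℝ =>
              1 + ‖gradient V p.1‖ ^ 2) :=
            (continuous_const.add (cG.comp continuous_fst)).measurable
          have m3 : Measurable (fun p : EuclideanSpace ℝ (Fin n) × ℝ => p.2⁻¹ ^ 2) :=
            measurable_snd.inv.pow_const _
          have m4 : Measurable (fun p : EuclideanSpace ℝ (Fin n) × ℝ => p.2 ^ (1 - α)) :=
            measurable_snd.pow_const _
          exact m1.mul (ENNReal.measurable_ofReal.comp (m4.mul (m2.min m3)))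
      _ ≤ ∫⁻ t in Ioc (0:ℝ) 1, ENNReal.ofReal C * (ENNReal.ofReal (t ^ (-1 - α) *
            ∫ x, osc f t x * Real.exp (-V x)) + ENNReal.ofReal (t ^ (1 - α)) * ENNReal.ofReal Q) := by
          apply setLIntegral_mono' measurableSet_Ioc
          intro t ht
          have ht0 := ht.1
          have hO0 : 0 ≤ ∫ x, osc f t x * Real.exp (-V x) :=
            integral_nonneg fun x => mul_nonneg (osc_nonneg _ _ _) (Real.exp_pos _).le
          calc _ = ENNReal.ofReal (t ^ (1 - α)) * ENNReal.ofReal (∫ x, f x ^ 2 * Real.exp (-V x) *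
                min (1 + ‖gradient V x‖ ^ 2) (t⁻¹ ^ 2)) := by
                rw [ofReal_integral_eq_lintegral_ofReal (hfi _ (by fun_prop))
                  (Eventually.of_forall fun x => by positivity),
                  ← lintegral_const_mul' _ _ ENNReal.ofReal_ne_top]
                congr 1; funext x
                rw [← ENNReal.ofReal_mul (by positivity), ← ENNReal.ofReal_mul (by positivity)]
                congr 1; ring
            _ ≤ ENNReal.ofReal (t ^ (1 - α)) * ENNReal.ofReal (C * (t⁻¹ ^ 2 *
                (∫ x, osc f t x * Real.exp (-V x)) + Q)) := by
                gcongr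
                exact hS f cf hfc t ht
            _ = _ := by
                rw [← ENNReal.ofReal_mul (by positivity), ← ENNReal.ofReal_mul (by positivity),
                  ← ENNReal.ofReal_add (by positivity) (by positivity),
                  ← ENNReal.ofReal_mul (by positivity)]
                congr 1
                have : t ^ (-1 - α) = t ^ (1 - α) * t⁻¹ ^ 2 := by
                  rw [inv_pow, ← Real.rpow_natCast, ← Real.rpow_neg ht0.le, ← Real.rpow_add ht0]
                  congr 1; push_cast; ring
                rw [this]; ring
      _ = ENNReal.ofReal C * ((∫⁻ t in Ioc (0:ℝ) 1, ENNReal.ofReal (t ^ (-1 - α) *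
            ∫ x, osc f t x * Real.exp (-V x))) + ENNReal.ofReal (2 - α)⁻¹ * ENNReal.ofReal Q) := by
          rw [lintegral_const_mul' _ _ ENNReal.ofReal_ne_top, lintegral_add_right _ (by
            apply Measurable.mul_const
            exact ENNReal.measurable_ofReal.comp (measurable_id.pow_const _)),
            lintegral_mul_const' _ _ ENNReal.ofReal_ne_top, hpow]
      _ ≤ _ := by
          gcongr
          exact osc_energy h0 V f cV cf hfc hMint
  have h3 := mul_le_mul_right key (ENNReal.ofReal (2 - α))
  rw [← mul_assoc, ← ENNReal.ofReal_mul h2'.le, mul_inv_cancel₀ h2'.ne', ENNReal.ofReal_one,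
    one_mul] at h3
  refine h3.trans ?_
  rw [ENNReal.ofReal_mul (by positivity), ENNReal.ofReal_mul (by positivity), mul_assoc, mul_assoc]
  gcongr
  rw [mul_add]
  gcongr
  · linarith [inv_pos.2 h2']
  · linarith [inv_pos.2 h2']

/-- the integrand of the fractional energy -/
noncomputable def fracKer {n : ℕ} (α : ℝ) (V f : EuclideanSpace ℝ (Fin n) → ℝ)
    (x y : EuclideanSpace ℝ (Fin n)) : ℝ :=
  |f x - f y| ^ 2 / ‖x - y‖ ^ ((n : ℝ) + α) * (Real.exp (-V x) * Real.exp (-1 * ‖x - y‖))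

lemma fracKer_nonneg {n : ℕ} (α : ℝ) (V f : EuclideanSpace ℝ (Fin n) → ℝ)
    (x y : EuclideanSpace ℝ (Fin n)) : 0 ≤ fracKer α V f x y := by
  unfold fracKer; positivity

lemma integrable_profile {n : ℕ} (hn : 1 ≤ n) {α : ℝ} (hα : α < 2) :
    Integrable (fun w : EuclideanSpace ℝ (Fin n) =>
      ‖w‖ ^ (2 - ((n : ℝ) + α)) * Real.exp (-1 * ‖w‖)) := by
  have : Nonempty (Fin n) := ⟨⟨0, hn⟩⟩
  have := (MeasureTheory.integrable_fun_norm_addHaar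
    (volume : Measure (EuclideanSpace ℝ (Fin n)))
    (f := fun r : ℝ => r ^ (2 - ((n : ℝ) + α)) * Real.exp (-1 * r))).2
  apply this
  have h := Real.GammaIntegral_convergent (s := 2 - α) (by linarith)
  refine h.congr_fun ?_ measurableSet_Ioi
  intro r hr
  have hr : 0 < r := hr
  simp only [finrank_euclideanSpace, Fintype.card_fin, smul_eq_mul]
  rw [← mul_assoc, ← Real.rpow_natCast, ← Real.rpow_add hr, mul_comm, neg_one_mul]
  congr 2
  push_cast [hn]
  ring

lemma fracKer_integrable {n : ℕ} (hn : 1 ≤ n) {α : ℝ} (hα : α < 2)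
    {V f : EuclideanSpace ℝ (Fin n) → ℝ} (hV : Continuous V) (hf : ContDiff ℝ 1 f)
    (hfc : HasCompactSupport f) (hMint : Integrable (fun x => Real.exp (-V x))) :
    Integrable (fun p : EuclideanSpace ℝ (Fin n) × EuclideanSpace ℝ (Fin n) =>
      fracKer α V f p.1 p.2) (volume.prod volume) := by
  obtain ⟨L, hL⟩ := ContDiff.lipschitzWith_of_hasCompactSupport hfc hf one_ne_zero
  have h1 := (hMint.convolution_integrand (ContinuousLinearMap.mul ℝ ℝ)
    (integrable_profile hn hα)).swap
  refine (h1.const_mul ((L : ℝ) ^ 2)).mono' ?_ ?_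
  · apply Measurable.aestronglyMeasurable
    unfold fracKer
    have cf := hf.continuous
    apply Measurable.mul
    · apply Measurable.div
      · exact Continuous.measurable (by fun_prop)
      · exact Measurable.pow_const (Continuous.measurable (by fun_prop)) _
    · exact Continuous.measurable (by fun_prop)
  · refine Eventually.of_forall fun p => ?_
    rw [Real.norm_of_nonneg (fracKer_nonneg _ _ _ _ _)]
    simp only [Function.comp, Prod.swap, ContinuousLinearMap.mul_apply', fracKer]
    rw [norm_sub_rev p.2 p.1]
    have h2 : |f p.1 - f p.2| ≤ L * ‖p.1 - p.2‖ := by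
      have := hL.dist_le_mul p.1 p.2
      rwa [Real.dist_eq, dist_eq_norm] at this
    rcases eq_or_ne p.1 p.2 with h | h
    · rw [h]; simp; positivity
    have h3 : 0 < ‖p.1 - p.2‖ := norm_pos_iff.2 (sub_ne_zero.2 h)
    rw [Real.rpow_sub h3, Real.rpow_two]
    calc _ ≤ (L * ‖p.1 - p.2‖) ^ 2 / ‖p.1 - p.2‖ ^ ((n : ℝ) + α) *
          (Real.exp (-V p.1) * Real.exp (-1 * ‖p.1 - p.2‖)) := by gcongr
      _ = _ := by ring

lemma energy_eq {n : ℕ} (hn : 1 ≤ n) {α : ℝ} (hα : α < 2)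
    {V f : EuclideanSpace ℝ (Fin n) → ℝ} (hV : Continuous V) (hf : ContDiff ℝ 1 f)
    (hfc : HasCompactSupport f) (hMint : Integrable (fun x => Real.exp (-V x))) :
    energy α V f = ENNReal.ofReal (∫ x, ∫ y, fracKer α V f x y) := by
  have hI := fracKer_integrable hn hα hV hf hfc hMint
  rw [← integral_prod _ hI, ofReal_integral_eq_lintegral_ofReal hI
    (Eventually.of_forall fun p => fracKer_nonneg _ _ _ _ _),
    lintegral_prod _ hI.1.aemeasurable.ennreal_ofReal]
  rfl

lemma variance_bound {n : ℕ} {α : ℝ} (hα : 0 < α)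
    {V : EuclideanSpace ℝ (Fin n) → ℝ} (hV : Continuous V) (r : ℝ) (hr : 0 < r) :
    ∃ C > (0:ℝ), ∀ f : EuclideanSpace ℝ (Fin n) → ℝ, Continuous f →
      Integrable (fun p : EuclideanSpace ℝ (Fin n) × EuclideanSpace ℝ (Fin n) =>
        fracKer α V f p.1 p.2) (volume.prod volume) →
      (∫ x in Metric.closedBall 0 r, Real.exp (-V x)) *
        (∫ x in Metric.closedBall 0 r, f x ^ 2 * Real.exp (-V x))
      ≤ C * (∫ x, ∫ y, fracKer α V f x y) + (∫ x in Metric.closedBall 0 r, f x * Real.exp (-V x)) ^ 2 := by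
  set K := Metric.closedBall (0 : EuclideanSpace ℝ (Fin n)) r with hKdef
  have hK : IsCompact K := isCompact_closedBall _ _
  have hKm : MeasurableSet K := Metric.isClosed_closedBall.measurableSet
  have cw : Continuous (fun x => Real.exp (-V x)) := by fun_prop
  obtain ⟨B, hB⟩ := (hK.image cw).bddAbove
  have hB' : ∀ x ∈ K, Real.exp (-V x) ≤ B := fun x hx => hB (mem_image_of_mem _ hx)
  have hB0 : 0 < B := lt_of_lt_of_le (Real.exp_pos _) (hB' 0 (by simp [hKdef, hr.le]))
  set p := (n : ℝ) + α with hp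
  have hp0 : 0 < p := by positivity
  set CK := B * ((2 * r) ^ p * Real.exp (2 * r)) with hCK
  have hCK0 : 0 < CK := by positivity
  refine ⟨CK, hCK0, ?_⟩
  intro f cf hI
  set m := ∫ x in K, Real.exp (-V x) with hm
  set P := ∫ x in K, f x ^ 2 * Real.exp (-V x) with hP
  set S := ∫ x in K, f x * Real.exp (-V x) with hS
  have hon : ∀ w : EuclideanSpace ℝ (Fin n) → ℝ, Continuous w → Integrable w (volume.restrict K) :=
    fun w h1 => h1.continuousOn.integrableOn_compact hK
  have hpt : ∀ x ∈ K, ∀ y ∈ K,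
      (f x - f y) ^ 2 * Real.exp (-V x) * Real.exp (-V y) ≤ CK * fracKer α V f x y := by
    intro x hx y hy
    rcases eq_or_ne x y with h | h
    · rw [h]
      simp only [sub_self, ne_eq, OfNat.ofNat_ne_zero, not_false_eq_true, zero_pow, zero_mul]
      exact mul_nonneg hCK0.le (fracKer_nonneg _ _ _ _ _)
    have h3 : 0 < ‖x - y‖ := norm_pos_iff.2 (sub_ne_zero.2 h)
    have h4 : ‖x - y‖ ≤ 2 * r := by
      have h5 := norm_sub_le x y
      have := mem_closedBall_zero_iff.1 hx
      have := mem_closedBall_zero_iff.1 hy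
      linarith
    have h5 : ‖x - y‖ ^ p ≤ (2 * r) ^ p := Real.rpow_le_rpow h3.le h4 hp0.le
    have h5' : 0 < ‖x - y‖ ^ p := by positivity
    have h6 : 1 ≤ (2 * r) ^ p / ‖x - y‖ ^ p := (one_le_div h5').2 h5
    have h7 : 1 ≤ Real.exp (2 * r) * Real.exp (-1 * ‖x - y‖) := by
      rw [← Real.exp_add]; apply Real.one_le_exp; linarith
    have h8 := one_le_mul_of_one_le_of_one_le h6 h7
    have h9 : 0 ≤ (f x - f y) ^ 2 * Real.exp (-V x) := by positivity
    calc _ ≤ (f x - f y) ^ 2 * Real.exp (-V x) * B := by gcongr; exact hB' y hy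
      _ ≤ (f x - f y) ^ 2 * Real.exp (-V x) * B * ((2 * r) ^ p / ‖x - y‖ ^ p *
          (Real.exp (2 * r) * Real.exp (-1 * ‖x - y‖))) :=
        le_mul_of_one_le_right (by positivity) h8
      _ = _ := by
        simp only [hCK, fracKer, sq_abs, ← hp]
        ring
  set H : EuclideanSpace ℝ (Fin n) × EuclideanSpace ℝ (Fin n) → ℝ :=
    fun q => (f q.1 - f q.2) ^ 2 * Real.exp (-V q.1) * Real.exp (-V q.2) with hH
  have hHi : IntegrableOn H (K ×ˢ K) (volume.prod volume) :=
    ContinuousOn.integrableOn_compact (hK.prod hK) (Continuous.continuousOn (by fun_prop))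
  have e1 : ∫ q in K ×ˢ K, H q ∂(volume.prod volume) = 2 * (m * P) - 2 * S ^ 2 := by
    rw [setIntegral_prod _ hHi]
    have inner : ∀ x, ∫ y in K, H (x, y) = m * (f x ^ 2 * Real.exp (-V x))
        - (2 * S) * (f x * Real.exp (-V x)) + P * Real.exp (-V x) := by
      intro x
      have : ∀ y, H (x, y) = (f x ^ 2 * Real.exp (-V x)) * Real.exp (-V y)
          - (2 * f x * Real.exp (-V x)) * (f y * Real.exp (-V y))
          + Real.exp (-V x) * (f y ^ 2 * Real.exp (-V y)) := by
        intro y; simp only [hH]; ring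
      simp_rw [this]
      rw [integral_add (hon _ (by fun_prop)) (hon _ (by fun_prop)),
        integral_sub (hon _ (by fun_prop)) (hon _ (by fun_prop)),
        integral_const_mul, integral_const_mul, integral_const_mul]
      ring
    simp_rw [inner]
    rw [integral_add (hon _ (by fun_prop)) (hon _ (by fun_prop)),
        integral_sub (hon _ (by fun_prop)) (hon _ (by fun_prop)),
        integral_const_mul, integral_const_mul, integral_const_mul]
    ring
  have e2 : ∫ q in K ×ˢ K, H q ∂(volume.prod volume) ≤ CK * ∫ x, ∫ y, fracKer α V f x y := by
    rw [← integral_prod _ hI, ← integral_const_mul]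
    calc _ ≤ ∫ q in K ×ˢ K, CK * fracKer α V f q.1 q.2 ∂(volume.prod volume) := by
          apply setIntegral_mono_on hHi (hI.const_mul _).integrableOn (hKm.prod hKm)
          intro q hq
          exact hpt q.1 hq.1 q.2 hq.2
      _ ≤ _ := setIntegral_le_integral (hI.const_mul _)
          (Eventually.of_forall fun q => mul_nonneg hCK0.le (fracKer_nonneg _ _ _ _ _))
  have e3 : 0 ≤ ∫ q in K ×ˢ K, H q ∂(volume.prod volume) :=
    integral_nonneg fun q => by simp only [hH]; positivity
  linarith

lemma main_aux {n : ℕ} (hn : 1 ≤ n) {V : EuclideanSpace ℝ (Fin n) → ℝ}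
    (hV : ContDiff ℝ 2 V) (hMint : Integrable (fun x => Real.exp (-V x)))
    (hconf : ∃ ε > (0:ℝ), Tendsto
      (fun x => (1 - ε) * ‖gradient V x‖ ^ 2 / 2 - laplacian V x)
      (cocompact (EuclideanSpace ℝ (Fin n))) atTop)
    {α : ℝ} (hα : α ∈ Ioo (0:ℝ) 2) :
    ∃ C > (0:ℝ), ∀ f : EuclideanSpace ℝ (Fin n) → ℝ,
      ContDiff ℝ 1 f → HasCompactSupport f → (∫ x, f x * Real.exp (-V x)) = 0 →
      ∫ x, f x ^ 2 * Real.exp (-V x) * (1 + ‖gradient V x‖ ^ 2) ^ (α / 2)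
        ≤ C * ∫ x, ∫ y, fracKer α V f x y := by
  obtain ⟨C, hC, R, hR, hF⟩ := frac_bound hV hMint hconf hα
  have hV1 : ContDiff ℝ 1 V := hV.of_le (by norm_num)
  have cV := hV.continuous
  have cG : Continuous (fun x => ‖gradient V x‖ ^ 2) := by
    simp_rw [norm_gradient_sq]
    exact continuous_finsetSum _ fun i _ => (continuous_fderiv_apply_const hV1 _).pow 2
  have hcont : Continuous (fun x => (1 + ‖gradient V x‖ ^ 2) ^ (α / 2)) :=
    (continuous_const.add cG).rpow_const fun x => Or.inr (by have := hα.1; linarith)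
  set tot := ∫ x, Real.exp (-V x) with htot
  have htot0 : 0 < tot := integral_exp_pos hMint
  have hlim : Tendsto (fun r : ℝ => ∫ x in Metric.closedBall 0 r, Real.exp (-V x)) atTop (nhds tot) :=
    (aecover_closedBall tendsto_id).integral_tendsto_of_countably_generated hMint
  have ev1 : ∀ᶠ r : ℝ in atTop, 0 < ∫ x in Metric.closedBall 0 r, Real.exp (-V x) :=
    hlim.eventually_const_lt htot0
  have ev2 : ∀ᶠ r : ℝ in atTop,
      0 < (∫ x in Metric.closedBall 0 r, Real.exp (-V x)) / 2
        - C * (tot - ∫ x in Metric.closedBall 0 r, Real.exp (-V x)) := by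
    apply ((hlim.div_const 2).sub ((tendsto_const_nhds.sub hlim).const_mul C)).eventually_const_lt
    simp [htot0]
  obtain ⟨r, hm0, hmC, hRr⟩ := (ev1.and (ev2.and (eventually_ge_atTop R))).exists
  have hr0 : 0 < r := lt_of_lt_of_le hR hRr
  obtain ⟨CK, hCK, hvar⟩ := variance_bound hα.1 cV r hr0
  set K := Metric.closedBall (0 : EuclideanSpace ℝ (Fin n)) r with hK
  have hKm : MeasurableSet K := Metric.isClosed_closedBall.measurableSet
  set m := ∫ x in K, Real.exp (-V x) with hm
  refine ⟨2 * C + 2 * C * CK / m, by positivity, ?_⟩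
  intro f hf hfc hmean
  have cf := hf.continuous
  have hkI := fracKer_integrable hn hα.2 cV hf hfc hMint
  have hF := hF f cf hfc
  rw [energy_eq hn hα.2 cV hf hfc hMint] at hF
  have hvar := hvar f cf hkI
  set E := ∫ x, ∫ y, fracKer α V f x y with hE
  have hE0 : 0 ≤ E := integral_nonneg fun x => integral_nonneg fun y => fracKer_nonneg _ _ _ _ _
  set Q := ∫ x in Metric.closedBall 0 R, f x ^ 2 * Real.exp (-V x) with hQ
  have hQ0 : 0 ≤ Q := integral_nonneg fun x => by positivity
  set A := ∫ x, f x ^ 2 * Real.exp (-V x) * (1 + ‖gradient V x‖ ^ 2) ^ (α / 2) with hA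
  rw [← ENNReal.ofReal_add hE0 hQ0, ← ENNReal.ofReal_mul hC.le,
    ENNReal.ofReal_le_ofReal_iff (by positivity)] at hF
  set P := ∫ x in K, f x ^ 2 * Real.exp (-V x) with hP
  have hfi : ∀ w : EuclideanSpace ℝ (Fin n) → ℝ, Continuous w →
      Integrable (fun x => f x ^ 2 * w x) := fun w hw =>
    Continuous.integrable_of_hasCompactSupport (by fun_prop)
      (HasCompactSupport.mul_right (hfc.comp_left (g := fun y : ℝ => y ^ 2) (by simp)))
  have hf1 : Integrable (fun x => f x * Real.exp (-V x)) :=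
    Continuous.integrable_of_hasCompactSupport (by fun_prop) hfc.mul_right
  have hQP : Q ≤ P := by
    apply setIntegral_mono_set (hfi _ (by fun_prop)).integrableOn
    · exact Eventually.of_forall fun x => by simp only [Pi.zero_apply]; positivity
    · exact (Metric.closedBall_subset_closedBall hRr).eventuallyLE
  have hS : (∫ x in K, f x * Real.exp (-V x)) ^ 2 ≤ (tot - m) * A := by
    have e1 : ∫ x in K, f x * Real.exp (-V x) = - ∫ x in Kᶜ, f x * Real.exp (-V x) := by
      have := integral_add_compl hKm hf1
      linarith
    have e2 : tot - m = ∫ x in Kᶜ, Real.exp (-V x) := by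
      have := integral_add_compl hKm hMint
      linarith
    have e3 : ∫ x in Kᶜ, f x ^ 2 * Real.exp (-V x) ≤ A := by
      calc _ ≤ ∫ x, f x ^ 2 * Real.exp (-V x) :=
            setIntegral_le_integral (hfi _ (by fun_prop))
              (Eventually.of_forall fun x => by simp only [Pi.zero_apply]; positivity)
        _ ≤ A := by
          apply integral_mono (hfi _ (by fun_prop))
          · simp_rw [mul_assoc]; exact hfi _ (by fun_prop)
          · intro x
            apply le_mul_of_one_le_right (by positivity)
            apply Real.one_le_rpow (by nlinarith [sq_nonneg ‖gradient V x‖])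
            have := hα.1; linarith
    have h := cs_weighted (volume.restrict Kᶜ) (fun _ => 1) f (fun x => Real.exp (-V x))
      (fun x => (Real.exp_pos _).le) (by simpa using hMint.restrict)
      (hfi _ (by fun_prop)).integrableOn (by simpa using hf1.restrict)
    simp only [one_mul, one_pow] at h
    rw [e1, neg_sq, e2]
    refine h.trans (mul_le_mul_of_nonneg_left e3 ?_)
    exact integral_nonneg fun x => (Real.exp_pos _).le
  have hA0 : 0 ≤ A := integral_nonneg fun x => by positivity
  have t1 : m * A ≤ C * m * E + C * (m * P) := by
    have := mul_le_mul_of_nonneg_left hF hm0.le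
    have := mul_le_mul_of_nonneg_left hQP (by positivity : 0 ≤ C * m)
    linarith
  have t2 : C * (m * P) ≤ C * (CK * E + (tot - m) * A) := by
    gcongr; linarith
  have t3 : C * (tot - m) * A ≤ m / 2 * A := by
    apply mul_le_mul_of_nonneg_right _ hA0
    linarith
  have t4 : m * A ≤ (2 * C * m + 2 * C * CK) * E := by linarith
  have t5 : (2 * C + 2 * C * CK / m) * E = ((2 * C * m + 2 * C * CK) * E) / m := by
    field_simp
  rw [t5, le_div_iff₀ hm0]
  linarith

theorem fractional_poincare_weighted {n : ℕ} (hn : 1 ≤ n)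
    (V M : EuclideanSpace ℝ (Fin n) → ℝ)
    (hV : ContDiff ℝ 2 V)
    (hM : ∀ x, M x = Real.exp (-V x))
    (hMint : Integrable M)
    (hconf : ∃ ε > (0:ℝ), Tendsto
      (fun x => (1 - ε) * ‖gradient V x‖ ^ 2 / 2 - laplacian V x)
      (cocompact (EuclideanSpace ℝ (Fin n))) atTop)
    (α : ℝ) (hα : α ∈ Set.Ioo (0:ℝ) 2) :
    ∃ lam > (0:ℝ), ∃ δ > (0:ℝ),
      ∀ f : EuclideanSpace ℝ (Fin n) → ℝ,
        ContDiff ℝ (⊤ : ℕ∞) f → HasCompactSupport f →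
        (∫ x, f x * M x) = 0 →
        (∫ x, ∫ y, |f x - f y| ^ 2 / ‖x - y‖ ^ ((n : ℝ) + α)
            * (M x * Real.exp (-δ * ‖x - y‖)))
          ≥ lam * ∫ x, |f x| ^ 2
              * (1 + ‖gradient (fun y => Real.log (M y)) x‖ ^ α) * M x := by
  obtain rfl : M = fun x => Real.exp (-V x) := funext hM
  obtain ⟨C, hC, hmain⟩ := main_aux hn hV hMint hconf hα
  refine ⟨1 / (2 * C), by positivity, 1, one_pos, ?_⟩
  intro f hf hfc hmean
  have hf1 : ContDiff ℝ 1 f := hf.of_le (by exact_mod_cast le_top)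
  have h1 := hmain f hf1 hfc hmean
  have cf := hf.continuous
  have hV1 : ContDiff ℝ 1 V := hV.of_le (by norm_num)
  have cV := hV.continuous
  have cG : Continuous (fun x => ‖gradient V x‖ ^ 2) := by
    simp_rw [norm_gradient_sq]
    exact continuous_finsetSum _ fun i _ => (continuous_fderiv_apply_const hV1 _).pow 2
  have hcont : Continuous (fun x => (1 + ‖gradient V x‖ ^ 2) ^ (α / 2)) :=
    (continuous_const.add cG).rpow_const fun x => Or.inr (by have := hα.1; linarith)
  have hgrad : ∀ x, ‖gradient (fun y => Real.log (Real.exp (-V y))) x‖ = ‖gradient V x‖ := by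
    intro x
    simp only [Real.log_exp]
    have e : ‖gradient (fun y => -V y) x‖ ^ 2 = ‖gradient V x‖ ^ 2 := by
      rw [norm_gradient_sq, norm_gradient_sq]
      simp [fderiv_fun_neg]
    exact (sq_eq_sq₀ (norm_nonneg _) (norm_nonneg _)).1 e
  have h2 : ∫ x, |f x| ^ 2 * (1 + ‖gradient (fun y => Real.log (Real.exp (-V y))) x‖ ^ α)
        * Real.exp (-V x)
      ≤ 2 * ∫ x, f x ^ 2 * Real.exp (-V x) * (1 + ‖gradient V x‖ ^ 2) ^ (α / 2) := by
    rw [← integral_const_mul]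
    apply integral_mono_of_nonneg
    · exact Eventually.of_forall fun x => by simp only [Pi.zero_apply]; positivity
    · apply Integrable.const_mul
      apply Continuous.integrable_of_hasCompactSupport (by fun_prop)
      exact HasCompactSupport.mul_right (HasCompactSupport.mul_right
        (hfc.comp_left (g := fun y : ℝ => y ^ 2) (by simp)))
    · refine Eventually.of_forall fun x => ?_
      simp only [hgrad, sq_abs]
      have hα2 : 0 ≤ α / 2 := by have := hα.1; linarith
      have a1 : (1:ℝ) ≤ (1 + ‖gradient V x‖ ^ 2) ^ (α / 2) :=
        Real.one_le_rpow (by nlinarith [sq_nonneg ‖gradient V x‖]) hα2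
      have a2 : ‖gradient V x‖ ^ α ≤ (1 + ‖gradient V x‖ ^ 2) ^ (α / 2) := by
        have : ‖gradient V x‖ ^ α = (‖gradient V x‖ ^ 2) ^ (α / 2) := by
          rw [← Real.rpow_two, ← Real.rpow_mul (norm_nonneg _)]
          congr 1; ring
        rw [this]
        apply Real.rpow_le_rpow (by positivity) (by linarith) hα2
      have := mul_le_mul_of_nonneg_left (add_le_add a1 a2)
        (mul_nonneg (sq_nonneg (f x)) (Real.exp_pos (-V x)).le)
      linarith
  have h3 : (∫ x, ∫ y, fracKer α V f x y) = ∫ x, ∫ y, |f x - f y| ^ 2 / ‖x - y‖ ^ ((n : ℝ) + α)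
            * (Real.exp (-V x) * Real.exp (-1 * ‖x - y‖)) := rfl
  rw [h3] at h1
  rw [ge_iff_le, one_div, inv_mul_le_iff₀ (by positivity)]
  linarith
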